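/- Suppose (a,b) ∈ ℝ/ℤ × [0,1] does not lie in the closure of the hyperbolic set H, and suppose the semiconjugacy φ_{a,b} is constant on some nondegenerate closed arc J of ℝ/ℤ. Then the union of the forward iterates ⋃_{n ≥ 0} f_{a,b}^n(J) is all of ℝ/ℤ, and φ_{a,b} is constant on all of ℝ/ℤ. -/

import Mathlib

open Set Filter Topology

noncomputable section

/-- Representative of a point of the circle in `[0,1)`. -/
noncomputable def rep (z : UnitAddCircle) : ℝ := (AddCircle.equivIco 1 0 z).val

/-- The straight sine map on `[0,1)`. -/
noncomputable def Sfun (t : ℝ) : ℝ := if t ≤ 1/2 then 4*t - 1 else -4*t + 3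

/-- The piecewise linear perturbation of the doubling map. -/
noncomputable def plpdm (a : UnitAddCircle) (b : ℝ) (z : UnitAddCircle) : UnitAddCircle :=
  ((2 * rep z + (b/2) * Sfun (rep z) : ℝ) : UnitAddCircle) + a

/-- The doubling map. -/
def Dbl (z : UnitAddCircle) : UnitAddCircle := z + z

/-- `x` is an attracting periodic point of `f` of exact period `n`. -/
def IsAttractingPeriodicPt (f : UnitAddCircle → UnitAddCircle) (n : ℕ)
    (x : UnitAddCircle) : Prop :=
  0 < n ∧ f^[n] x = x ∧ (∀ m, 0 < m → m < n → f^[m] x ≠ x) ∧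
  ∃ U : Set UnitAddCircle, IsOpen U ∧ IsConnected U ∧ x ∈ U ∧ f^[n] '' U ⊆ U ∧
    ∀ y ∈ U, Tendsto (fun k => f^[n*k] y) atTop (nhds x)

/-- Forward orbit of `x` under `f`. -/
def orbitSet (f : UnitAddCircle → UnitAddCircle) (x : UnitAddCircle) : Set UnitAddCircle :=
  {y | ∃ i, f^[i] x = y}

/-- Basin of attraction of the set `O`. -/
def basin (f : UnitAddCircle → UnitAddCircle) (O : Set UnitAddCircle) : Set UnitAddCircle :=
  {y | Tendsto (fun k => Metric.infDist (f^[k] y) O) atTop (nhds 0)}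

/-- Immediate basin of attraction of the orbit `O`. -/
def immBasin (f : UnitAddCircle → UnitAddCircle) (O : Set UnitAddCircle) :
    Set UnitAddCircle :=
  ⋃ z ∈ O, connectedComponentIn (basin f O) z

/-- The hyperbolic set `H`. -/
def hypSet : Set (UnitAddCircle × ℝ) :=
  {q | q.2 ∈ Set.Ico (0:ℝ) 1 ∧ ∃ n x, IsAttractingPeriodicPt (plpdm q.1 q.2) n x}

/-- The lift `F_{a,b}` of `f_{a,b}`, normalized so that `F_{a,b}(0) ∈ [0,1)`. -/
noncomputable def liftF (a : UnitAddCircle) (b : ℝ) (x : ℝ) : ℝ :=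
  (2 * Int.fract x + rep a + (b/2) * Sfun (Int.fract x)
    + (if rep a - b/2 < 0 then 1 else 0)) + 2 * (⌊x⌋ : ℝ)

/-- `Φ_{a,b}`, the limit of `F_{a,b}^n(x)/2^n`. -/
noncomputable def Phi (a : UnitAddCircle) (b : ℝ) (x : ℝ) : ℝ :=
  limUnder atTop (fun n : ℕ => (liftF a b)^[n] x / 2 ^ n)

/-- The semiconjugacy `φ_{a,b}` induced by `Φ_{a,b}`. -/
noncomputable def phiMap (a : UnitAddCircle) (b : ℝ) (z : UnitAddCircle) : UnitAddCircle :=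
  ((Phi a b (rep z) : ℝ) : UnitAddCircle)

/-- The arc `I₊ = [0,1/2]` of the circle. -/
def Iplus : Set UnitAddCircle := (fun t : ℝ => (t : UnitAddCircle)) '' Set.Icc 0 (1/2)

/-- The arc `I₋ = [1/2,1]` of the circle. -/
def Iminus : Set UnitAddCircle := (fun t : ℝ => (t : UnitAddCircle)) '' Set.Icc (1/2) 1

/-- The orbit of `x` (of period `p`) avoids `0`, `1/2` and has slope itinerary `σ`,
where `σ j = true` encodes the symbol `−` and `σ j = false` encodes `+`. -/
def HasItinerary (f : UnitAddCircle → UnitAddCircle) (p : ℕ) (x : UnitAddCircle)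
    (σ : Fin p → Bool) : Prop :=
  (∀ j : Fin p, f^[(j : ℕ)] x ≠ (0 : UnitAddCircle) ∧
      f^[(j : ℕ)] x ≠ (((1:ℝ)/2 : ℝ) : UnitAddCircle)) ∧
  ∀ j : Fin p, (σ j = true → f^[(j : ℕ)] x ∈ Iminus) ∧ (σ j = false → f^[(j : ℕ)] x ∈ Iplus)

/-- The set `P_σ` of parameters whose attracting orbit has slope itinerary `σ`. -/
def paramSet (p : ℕ) (σ : Fin p → Bool) : Set (UnitAddCircle × ℝ) :=
  {q | q.2 ∈ Set.Ico (0:ℝ) 1 ∧ ∃ x, IsAttractingPeriodicPt (plpdm q.1 q.2) p x ∧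
       HasItinerary (plpdm q.1 q.2) p x σ}

/-- `S` is a tongue: its closure meets `ℝ/ℤ × {1}` in a nondegenerate interval. -/
def IsTongue (S : Set (UnitAddCircle × ℝ)) : Prop :=
  ∃ u v : ℝ, u < v ∧ ∀ t ∈ Set.Icc u v, (((t : ℝ) : UnitAddCircle), (1:ℝ)) ∈ closure S

end

/-- The triangle wave `x ↦ S (x mod 1)`. -/
noncomputable def triWave (x : ℝ) : ℝ := 1 - 4 * |Int.fract x - 1 / 2|

/-- The lift of `f_{a,b}` associated with a real representative `α` of `a`. -/
noncomputable def linLift (α b x : ℝ) : ℝ := 2 * x + α + b / 2 * triWave x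

lemma Sfun_fract (x : ℝ) : Sfun (Int.fract x) = triWave x := by
  unfold Sfun triWave
  split_ifs with h
  · rw [abs_of_nonpos (by linarith)]; ring
  · rw [abs_of_nonneg (by linarith)]; ring

lemma triWave_eq {x : ℝ} {k : ℤ} (h₁ : (k : ℝ) ≤ x) (h₂ : x ≤ k + 1) :
    triWave x = 1 - 4 * |x - k - 1 / 2| := by
  unfold triWave
  rcases h₂.lt_or_eq with h₂ | h₂
  · have : ⌊x⌋ = k := Int.floor_eq_iff.2 ⟨h₁, h₂⟩
    rw [Int.fract, this]
  · have : Int.fract x = 0 := by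
      rw [h₂]; exact_mod_cast Int.fract_intCast (k + 1)
    rw [this, h₂]
    norm_num [abs_of_nonneg]

lemma triWave_left {x : ℝ} {k : ℤ} (h₁ : (k : ℝ) ≤ x) (h₂ : x ≤ k + 1 / 2) :
    triWave x = 4 * (x - k) - 1 := by
  rw [triWave_eq h₁ (by linarith), abs_of_nonpos (by linarith)]; ring

lemma triWave_right {x : ℝ} {k : ℤ} (h₁ : (k : ℝ) + 1 / 2 ≤ x) (h₂ : x ≤ k + 1) :
    triWave x = 3 - 4 * (x - k) := by
  rw [triWave_eq (by linarith) h₂, abs_of_nonneg (by linarith)]; ring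

lemma triWave_add_int (x : ℝ) (k : ℤ) : triWave (x + k) = triWave x := by
  simp [triWave]

lemma le_triWave (x : ℝ) (k : ℤ) : 1 - 4 * |x - k - 1 / 2| ≤ triWave x := by
  unfold triWave
  have h0 := Int.fract_nonneg x
  have h1 := Int.fract_lt_one x
  have hx : x = ⌊x⌋ + Int.fract x := (Int.floor_add_fract x).symm
  have key : |Int.fract x - 1 / 2| ≤ |x - k - 1 / 2| := by
    rcases lt_trichotomy k ⌊x⌋ with h | h | h
    · have : (k : ℝ) + 1 ≤ ⌊x⌋ := by exact_mod_cast h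
      refine abs_le.2 ⟨?_, ?_⟩ <;>
        [linarith [neg_abs_le (x - k - 1 / 2), le_abs_self (x - k - 1 / 2)];
         linarith [le_abs_self (x - k - 1 / 2)]]
    · rw [h, Int.fract]
    · have : (⌊x⌋ : ℝ) + 1 ≤ k := by exact_mod_cast h
      refine abs_le.2 ⟨?_, ?_⟩ <;> linarith [neg_abs_le (x - k - 1 / 2)]
  linarith

lemma triWave_sub_le (x y : ℝ) : triWave x - triWave y ≤ 4 * |x - y| := by
  have h₁ := le_triWave y ⌊x⌋
  have h₂ : triWave x = 1 - 4 * |x - ⌊x⌋ - 1 / 2| := rfl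
  have h₃ : |y - ⌊x⌋ - 1 / 2| ≤ |x - ⌊x⌋ - 1 / 2| + |x - y| := by
    have := abs_sub_le (y - ⌊x⌋ - 1 / 2) (x - ⌊x⌋ - 1 / 2) 0
    rw [show y - ⌊x⌋ - 1 / 2 - (x - ⌊x⌋ - 1 / 2) = -(x - y) by ring, abs_neg] at this
    simpa [add_comm] using this
  linarith

lemma continuous_triWave : Continuous triWave := by
  have : LipschitzWith 4 triWave := LipschitzWith.of_le_add_mul 4 fun x y => by
    have := triWave_sub_le x y
    rw [Real.dist_eq]
    push_cast
    linarith
  exact this.continuous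

lemma abs_triWave_le (x : ℝ) : |triWave x| ≤ 1 := by
  unfold triWave
  have h0 := Int.fract_nonneg x
  have h1 := Int.fract_lt_one x
  have : |Int.fract x - 1 / 2| ≤ 1 / 2 := abs_le.2 ⟨by linarith, by linarith⟩
  have := abs_nonneg (Int.fract x - 1 / 2)
  exact abs_le.2 ⟨by linarith, by linarith⟩

lemma linLift_add_int (α b x : ℝ) (k : ℤ) :
    linLift α b (x + k) = linLift α b x + (2 * k : ℤ) := by
  simp only [linLift, triWave_add_int]; push_cast; ring

lemma linLift_sub_le {α b x y : ℝ} (hb : 0 ≤ b) (h : x ≤ y) :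
    linLift α b y - linLift α b x ≤ (2 + 2 * b) * (y - x) := by
  have := triWave_sub_le y x
  rw [abs_of_nonneg (by linarith)] at this
  unfold linLift
  nlinarith

lemma le_linLift_sub {α b x y : ℝ} (hb : 0 ≤ b) (h : x ≤ y) :
    (2 - 2 * b) * (y - x) ≤ linLift α b y - linLift α b x := by
  have := triWave_sub_le x y
  rw [abs_of_nonpos (by linarith)] at this
  unfold linLift
  nlinarith

lemma monotone_linLift {α b : ℝ} (hb : b ∈ Icc (0 : ℝ) 1) : Monotone (linLift α b) := by
  intro x y h
  have := le_linLift_sub (α := α) hb.1 h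
  nlinarith [hb.2]

lemma strictMono_linLift {α b : ℝ} (hb : b ∈ Ico (0 : ℝ) 1) : StrictMono (linLift α b) := by
  intro x y h
  have := le_linLift_sub (α := α) hb.1 h.le
  nlinarith [hb.2]

lemma continuous_iterate_linLift (n : ℕ) :
    Continuous fun q : (ℝ × ℝ) × ℝ => (linLift q.1.1 q.1.2)^[n] q.2 := by
  induction n with
  | zero => simpa using continuous_snd
  | succ n ih =>
    simp only [Function.iterate_succ_apply', linLift] at ih ⊢
    have := continuous_triWave
    fun_prop

lemma continuous_linLift (α b : ℝ) : Continuous (linLift α b) := by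
  have := continuous_triWave
  unfold linLift; fun_prop

lemma surjective_linLift {α b : ℝ} (hb : b ∈ Icc (0 : ℝ) 1) :
    Function.Surjective (linLift α b) := by
  intro y
  have bd : ∀ x, |linLift α b x - (2 * x + α)| ≤ 1 / 2 := fun x => by
    rw [show linLift α b x - (2 * x + α) = b / 2 * triWave x by unfold linLift; ring, abs_mul,
      abs_of_nonneg (by linarith [hb.1])]
    have := abs_triWave_le x
    nlinarith [hb.1, hb.2, abs_nonneg (triWave x)]
  have h₁ := abs_le.1 (bd ((y - α - 1) / 2))
  have h₂ := abs_le.1 (bd ((y - α + 1) / 2))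
  obtain ⟨x, -, hx⟩ := intermediate_value_Icc (show (y - α - 1) / 2 ≤ (y - α + 1) / 2 by linarith)
    (continuous_linLift α b).continuousOn
    (show y ∈ Icc _ _ from ⟨by linarith, by linarith⟩)
  exact ⟨x, hx⟩

lemma iterate_linLift_add_int (α b x : ℝ) (n : ℕ) (k : ℤ) :
    (linLift α b)^[n] (x + k) = (linLift α b)^[n] x + (2 ^ n * k : ℤ) := by
  induction n with
  | zero => simp
  | succ n ih =>
    rw [Function.iterate_succ_apply', ih, linLift_add_int, Function.iterate_succ_apply']
    congr 2; ring

/-- Raising the parameter `α` raises every positive iterate by at least as much. -/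
lemma iterate_linLift_add_le {α α' b : ℝ} (hb : b ∈ Icc (0 : ℝ) 1) (h : α ≤ α') (x : ℝ) {n : ℕ}
    (hn : 0 < n) : (linLift α b)^[n] x + (α' - α) ≤ (linLift α' b)^[n] x := by
  have step : ∀ y, linLift α b y + (α' - α) = linLift α' b y := fun y => by
    unfold linLift; ring
  have weak : ∀ m : ℕ, (linLift α b)^[m] x ≤ (linLift α' b)^[m] x := fun m => by
    induction m with
    | zero => exact le_rfl
    | succ m ih =>
      rw [Function.iterate_succ_apply', Function.iterate_succ_apply', ← step]
      have := monotone_linLift (α := α) hb ih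
      linarith
  obtain ⟨m, rfl⟩ := Nat.exists_eq_succ_of_ne_zero hn.ne'
  rw [Function.iterate_succ_apply', Function.iterate_succ_apply', ← step]
  have := monotone_linLift (α := α) hb (weak m)
  linarith

lemma rep_coe (x : ℝ) : rep (x : UnitAddCircle) = Int.fract x := by
  simp [rep, AddCircle.coe_equivIco_mk_apply]

lemma coe_rep (z : UnitAddCircle) : ((rep z : ℝ) : UnitAddCircle) = z :=
  (AddCircle.equivIco 1 0).symm_apply_apply z

lemma coe_add_intCast (x : ℝ) (k : ℤ) : ((x + k : ℝ) : UnitAddCircle) = x := by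
  rw [AddCircle.coe_add]
  have : ((k : ℝ) : UnitAddCircle) = 0 := by
    rw [AddCircle.coe_eq_zero_iff]; exact ⟨k, by simp⟩
  rw [this, add_zero]

lemma coe_eq_coe_iff {x y : ℝ} :
    ((x : ℝ) : UnitAddCircle) = y ↔ ∃ k : ℤ, x = y + k := by
  constructor
  · intro h
    have : ((x - y : ℝ) : UnitAddCircle) = 0 := by rw [AddCircle.coe_sub, h, sub_self]
    obtain ⟨k, hk⟩ := (AddCircle.coe_eq_zero_iff _).1 this
    refine ⟨k, ?_⟩
    simp at hk
    linarith
  · rintro ⟨k, rfl⟩; exact coe_add_intCast y k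

lemma plpdm_coe (α b x : ℝ) :
    plpdm (α : UnitAddCircle) b (x : UnitAddCircle) = (linLift α b x : ℝ) := by
  unfold plpdm
  rw [rep_coe, Sfun_fract, ← AddCircle.coe_add, ← coe_add_intCast _ (2 * ⌊x⌋)]
  congr 1
  unfold linLift triWave
  push_cast; linarith [Int.floor_add_fract x]

lemma iterate_plpdm_coe (α b x : ℝ) (n : ℕ) :
    (plpdm (α : UnitAddCircle) b)^[n] (x : UnitAddCircle) = ((linLift α b)^[n] x : ℝ) := by
  induction n with
  | zero => rfl
  | succ n ih => rw [Function.iterate_succ_apply', ih, plpdm_coe, Function.iterate_succ_apply']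

lemma liftF_eq (a : UnitAddCircle) (b : ℝ) :
    liftF a b = linLift (rep a + if rep a - b / 2 < 0 then 1 else 0) b := by
  funext x
  unfold liftF linLift
  rw [Sfun_fract]
  linarith [Int.floor_add_fract x]

/-- A strictly increasing continuous map moving the points of `(x - η, x + η)` strictly towards its
fixed point `x` attracts all of them to `x`. -/
lemma tendsto_iterate_of_contracts {h : ℝ → ℝ} (hc : Continuous h) (hm : StrictMono h) {x η : ℝ}
    (hx : h x = x) (hr : ∀ y ∈ Ioo x (x + η), h y < y) (hl : ∀ y ∈ Ioo (x - η) x, y < h y) :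
    MapsTo h (Ioo (x - η) (x + η)) (Ioo (x - η) (x + η)) ∧
    ∀ y ∈ Ioo (x - η) (x + η), Tendsto (fun k => h^[k] y) atTop (𝓝 x) := by
  have hR : ∀ y ∈ Ico x (x + η), x ≤ h y ∧ h y ≤ y := fun y hy => by
    rcases hy.1.eq_or_lt with e | e
    · rw [← e, hx]; simp
    · exact ⟨hx ▸ hm.monotone hy.1, (hr y ⟨e, hy.2⟩).le⟩
  have hL : ∀ y ∈ Ioc (x - η) x, y ≤ h y ∧ h y ≤ x := fun y hy => by
    rcases hy.2.eq_or_lt with e | e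
    · rw [e, hx]; simp
    · exact ⟨(hl y ⟨hy.1, e⟩).le, hx ▸ hm.monotone hy.2⟩
  refine ⟨fun y hy => ?_, fun y hy => ?_⟩
  · rcases le_total x y with e | e
    · have := hR y ⟨e, hy.2⟩
      exact ⟨by linarith [hy.1, hy.2], by linarith [hy.2]⟩
    · have := hL y ⟨hy.1, e⟩
      exact ⟨by linarith [hy.1], by linarith [hy.1, hy.2]⟩
  · rcases le_total x y with e | e
    · have inv : ∀ k, h^[k] y ∈ Icc x y := fun k => by
        induction k with
        | zero => exact ⟨e, le_rfl⟩
        | succ k ih =>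
          rw [Function.iterate_succ_apply']
          have := hR _ ⟨ih.1, ih.2.trans_lt hy.2⟩
          exact ⟨this.1, this.2.trans ih.2⟩
      have anti : Antitone fun k => h^[k] y := antitone_nat_of_succ_le fun k => by
        rw [Function.iterate_succ_apply']
        exact (hR _ ⟨(inv k).1, (inv k).2.trans_lt hy.2⟩).2
      have lim := tendsto_atTop_ciInf anti ⟨x, by rintro _ ⟨k, rfl⟩; exact (inv k).1⟩
      set l := ⨅ k, h^[k] y
      have hl' : l ∈ Icc x y := isClosed_Icc.mem_of_tendsto lim (.of_forall inv)
      have fix : h l = l := isFixedPt_of_tendsto_iterate lim hc.continuousAt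
      rcases hl'.1.eq_or_lt with e' | e'
      · rwa [← e'] at lim
      · exact absurd fix (hr l ⟨e', hl'.2.trans_lt hy.2⟩).ne
    · have inv : ∀ k, h^[k] y ∈ Icc y x := fun k => by
        induction k with
        | zero => exact ⟨le_rfl, e⟩
        | succ k ih =>
          rw [Function.iterate_succ_apply']
          have := hL _ ⟨hy.1.trans_le ih.1, ih.2⟩
          exact ⟨ih.1.trans this.1, this.2⟩
      have mono : Monotone fun k => h^[k] y := monotone_nat_of_le_succ fun k => by
        rw [Function.iterate_succ_apply']
        exact (hL _ ⟨hy.1.trans_le (inv k).1, (inv k).2⟩).1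
      have lim := tendsto_atTop_ciSup mono ⟨x, by rintro _ ⟨k, rfl⟩; exact (inv k).2⟩
      set l := ⨆ k, h^[k] y
      have hl' : l ∈ Icc y x := isClosed_Icc.mem_of_tendsto lim (.of_forall inv)
      have fix : h l = l := isFixedPt_of_tendsto_iterate lim hc.continuousAt
      rcases hl'.2.eq_or_lt with e' | e'
      · rwa [e'] at lim
      · exact absurd fix (hl l ⟨hy.1.trans_le hl'.1, e'⟩).ne'

lemma continuous_iterate_linLift_right (α b : ℝ) (n : ℕ) : Continuous (linLift α b)^[n] :=
  (continuous_linLift α b).iterate n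

lemma continuous_iterate_linLift_param (x : ℝ) (n : ℕ) :
    Continuous fun q : ℝ × ℝ => (linLift q.1 q.2)^[n] x :=
  (continuous_iterate_linLift n).comp (Continuous.prodMk continuous_id continuous_const)

/-- An isolated fixed point of `F^p - m` at which the graph crosses the diagonal downwards gives an
attracting periodic point. -/
lemma mem_hypSet_of_contracts {α b : ℝ} (hb : b ∈ Ico (0 : ℝ) 1) {p : ℕ} (hp : 0 < p) {m : ℤ}
    {x η : ℝ} (hη : 0 < η) (hx : (linLift α b)^[p] x = x + m)
    (hr : ∀ y ∈ Ioo x (x + η), (linLift α b)^[p] y < y + m)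
    (hl : ∀ y ∈ Ioo (x - η) x, y + m < (linLift α b)^[p] y) :
    ((α : UnitAddCircle), b) ∈ hypSet := by
  set f := plpdm (α : UnitAddCircle) b
  set F := linLift α b
  have hper : Function.IsPeriodicPt f p (x : UnitAddCircle) := by
    change f^[p] _ = _
    rw [iterate_plpdm_coe]
    change ((F^[p] x : ℝ) : UnitAddCircle) = _
    rw [hx, coe_add_intCast]
  set n := Function.minimalPeriod f (x : UnitAddCircle) with hn_def
  have hn : 0 < n := hper.minimalPeriod_pos hp
  obtain ⟨r, hr'⟩ : n ∣ p := hper.minimalPeriod_dvd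
  have hfix : f^[n] (x : UnitAddCircle) = x := Function.iterate_minimalPeriod
  obtain ⟨m', hm'⟩ : ∃ k : ℤ, F^[n] x = x + k := by
    rw [iterate_plpdm_coe] at hfix
    exact coe_eq_coe_iff.1 hfix
  set h : ℝ → ℝ := fun y => F^[n] y - m' with h_def
  have hmono : StrictMono h := fun y z hyz => by
    have := (strictMono_linLift (α := α) hb).iterate n hyz
    change F^[n] y < F^[n] z at this
    simp only [h_def]; linarith
  have hcont : Continuous h := (continuous_iterate_linLift_right α b n).sub continuous_const
  have hhx : h x = x := by simp only [h_def]; linarith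
  have iter : ∀ k : ℕ, ∃ c : ℤ, ∀ y, F^[n * k] y = h^[k] y + c := fun k => by
    induction k with
    | zero => exact ⟨0, fun y => by simp⟩
    | succ k ih =>
      obtain ⟨c, hc⟩ := ih
      refine ⟨m' + 2 ^ n * c, fun y => ?_⟩
      rw [Nat.mul_succ, add_comm, Function.iterate_add_apply, hc, iterate_linLift_add_int,
        Function.iterate_succ_apply']
      simp only [h_def]; push_cast; ring
  have iter_r : ∀ y, F^[p] y = h^[r] y + m := by
    obtain ⟨c, hc⟩ := iter r
    rw [← hr'] at hc
    have h1 := hc x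
    rw [Function.iterate_fixed hhx, hx] at h1
    have : (m : ℝ) = c := by linarith
    rw [this]; exact hc
  have hR : ∀ y ∈ Ioo x (x + η), h y < y := fun y hy => by
    by_contra! hcon
    have h1 := hr y hy
    rw [iter_r] at h1
    have h2 := hmono.monotone.monotone_iterate_of_le_map hcon (Nat.zero_le r)
    simp only [Function.iterate_zero, id] at h2
    linarith
  have hL : ∀ y ∈ Ioo (x - η) x, y < h y := fun y hy => by
    by_contra! hcon
    have h1 := hl y hy
    rw [iter_r] at h1
    have h2 := hmono.monotone.antitone_iterate_of_map_le hcon (Nat.zero_le r)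
    simp only [Function.iterate_zero, id] at h2
    linarith
  obtain ⟨hmaps, hlim⟩ := tendsto_iterate_of_contracts hcont hmono hhx hR hL
  refine ⟨hb, n, x, hn, hfix, fun k hk hkn hk' => ?_,
    (fun t : ℝ => (t : UnitAddCircle)) '' Ioo (x - η) (x + η), ?_, ?_, ?_, ?_, ?_⟩
  · exact absurd (Function.IsPeriodicPt.minimalPeriod_le hk hk') (not_le.2 hkn)
  · exact QuotientAddGroup.isOpenMap_coe _ isOpen_Ioo
  · exact (isConnected_Ioo (by linarith)).image _ (AddCircle.continuous_mk' 1).continuousOn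
  · exact ⟨x, ⟨by linarith, by linarith⟩, rfl⟩
  · rintro _ ⟨_, ⟨y, hy, rfl⟩, rfl⟩
    refine ⟨h y, hmaps hy, ?_⟩
    change _ = f^[n] (y : UnitAddCircle)
    rw [iterate_plpdm_coe]
    exact (coe_eq_coe_iff.2 ⟨m', by simp [h_def, F]⟩).symm
  · rintro _ ⟨y, hy, rfl⟩
    have : (fun k => f^[n * k] (y : UnitAddCircle)) = fun k => ((h^[k] y : ℝ) : UnitAddCircle) := by
      funext k
      obtain ⟨c, hc⟩ := iter k
      rw [iterate_plpdm_coe]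
      exact coe_eq_coe_iff.2 ⟨c, hc y⟩
    change Tendsto (fun k => f^[n * k] (y : UnitAddCircle)) atTop _
    rw [this]
    exact ((AddCircle.continuous_mk' 1).tendsto x).comp (hlim y hy)

/-- The slopes that `F^p` can have on its pieces of linearity. -/
noncomputable def pieceSlope (i j : ℕ) (b : ℝ) : ℝ := (2 + 2 * b) ^ i * (2 - 2 * b) ^ j

lemma pieceSlope_pos {i j : ℕ} {b : ℝ} (hb : b ∈ Ico (0 : ℝ) 1) : 0 < pieceSlope i j b := by
  have h1 : 0 < 2 + 2 * b := by linarith [hb.1]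
  have h2 : 0 < 2 - 2 * b := by linarith [hb.2]
  unfold pieceSlope; positivity

lemma linLift_affine_right (α b x : ℝ) : ∃ η > 0, ∃ i j : ℕ, i + j = 1 ∧ ∀ y ∈ Icc x (x + η),
    linLift α b y = linLift α b x + pieceSlope i j b * (y - x) := by
  have h1 := Int.floor_le x
  have h2 := Int.lt_floor_add_one x
  rcases lt_or_ge x (⌊x⌋ + 1 / 2) with h | h
  · refine ⟨⌊x⌋ + 1 / 2 - x, by linarith, 1, 0, rfl, fun y hy => ?_⟩
    simp only [linLift, pieceSlope, triWave_left h1 h.le,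
      triWave_left (h1.trans hy.1) (by linarith [hy.2])]
    ring
  · refine ⟨⌊x⌋ + 1 - x, by linarith, 0, 1, rfl, fun y hy => ?_⟩
    simp only [linLift, pieceSlope, triWave_right h h2.le,
      triWave_right (h.trans hy.1) (by linarith [hy.2])]
    ring

lemma linLift_affine_left (α b x : ℝ) : ∃ η > 0, ∃ i j : ℕ, i + j = 1 ∧ ∀ y ∈ Icc (x - η) x,
    linLift α b y = linLift α b x + pieceSlope i j b * (y - x) := by
  have h1 := Int.ceil_lt_add_one x
  have h2 := Int.le_ceil x
  have e : ((⌈x⌉ - 1 : ℤ) : ℝ) = ⌈x⌉ - 1 := by push_cast; rfl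
  rcases le_or_gt x (⌈x⌉ - 1 / 2) with h | h
  · refine ⟨x - (⌈x⌉ - 1), by linarith, 1, 0, rfl, fun y hy => ?_⟩
    simp only [linLift, pieceSlope,
      triWave_left (k := ⌈x⌉ - 1) (x := x) (by linarith) (by linarith),
      triWave_left (k := ⌈x⌉ - 1) (x := y) (by linarith [hy.1]) (by linarith [hy.2])]
    ring
  · refine ⟨x - (⌈x⌉ - 1 / 2), by linarith, 0, 1, rfl, fun y hy => ?_⟩
    simp only [linLift, pieceSlope,
      triWave_right (k := ⌈x⌉ - 1) (x := x) (by linarith) (by linarith),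
      triWave_right (k := ⌈x⌉ - 1) (x := y) (by linarith [hy.1]) (by linarith [hy.2])]
    ring

lemma pieceSlope_mul (i j i' j' : ℕ) (b : ℝ) :
    pieceSlope i j b * pieceSlope i' j' b = pieceSlope (i + i') (j + j') b := by
  unfold pieceSlope; ring

lemma iterate_linLift_affine_right {α b : ℝ} (hb : b ∈ Ico (0 : ℝ) 1) (x : ℝ) (p : ℕ) :
    ∃ η > 0, ∃ i j : ℕ, i + j = p ∧ ∀ y ∈ Icc x (x + η),
      (linLift α b)^[p] y = (linLift α b)^[p] x + pieceSlope i j b * (y - x) := by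
  induction p with
  | zero => exact ⟨1, one_pos, 0, 0, rfl, fun y _ => by simp [pieceSlope]⟩
  | succ p ih =>
    obtain ⟨η, hη, i, j, hij, h⟩ := ih
    obtain ⟨η', hη', i', j', hij', h'⟩ := linLift_affine_right α b ((linLift α b)^[p] x)
    have hs := pieceSlope_pos (i := i) (j := j) hb
    refine ⟨min η (η' / pieceSlope i j b), by positivity, i' + i, j' + j, by omega, fun y hy => ?_⟩
    have hy₂ : y - x ≤ η' / pieceSlope i j b := by
      linarith [hy.2, min_le_right η (η' / pieceSlope i j b)]
    have e := h y ⟨hy.1, by linarith [hy.2, min_le_left η (η' / pieceSlope i j b)]⟩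
    rw [le_div_iff₀ hs] at hy₂
    rw [Function.iterate_succ_apply', Function.iterate_succ_apply', h', e, ← pieceSlope_mul]
    · ring
    · rw [e]
      have := mul_nonneg hs.le (sub_nonneg.2 hy.1)
      exact ⟨by linarith, by linarith⟩

lemma iterate_linLift_affine_left {α b : ℝ} (hb : b ∈ Ico (0 : ℝ) 1) (x : ℝ) (p : ℕ) :
    ∃ η > 0, ∃ i j : ℕ, i + j = p ∧ ∀ y ∈ Icc (x - η) x,
      (linLift α b)^[p] y = (linLift α b)^[p] x + pieceSlope i j b * (y - x) := by
  induction p with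
  | zero => exact ⟨1, one_pos, 0, 0, rfl, fun y _ => by simp [pieceSlope]⟩
  | succ p ih =>
    obtain ⟨η, hη, i, j, hij, h⟩ := ih
    obtain ⟨η', hη', i', j', hij', h'⟩ := linLift_affine_left α b ((linLift α b)^[p] x)
    have hs := pieceSlope_pos (i := i) (j := j) hb
    refine ⟨min η (η' / pieceSlope i j b), by positivity, i' + i, j' + j, by omega, fun y hy => ?_⟩
    have hy₂ : x - y ≤ η' / pieceSlope i j b := by
      linarith [hy.1, min_le_right η (η' / pieceSlope i j b)]
    have e := h y ⟨by linarith [hy.1, min_le_left η (η' / pieceSlope i j b)], hy.2⟩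
    rw [le_div_iff₀ hs] at hy₂
    rw [Function.iterate_succ_apply', Function.iterate_succ_apply', h', e, ← pieceSlope_mul]
    · ring
    · rw [e]
      have := mul_nonneg hs.le (sub_nonneg.2 hy.2)
      exact ⟨by linarith, by linarith⟩

lemma mem_hypSet_of_crossing {α b : ℝ} (hb : b ∈ Ico (0 : ℝ) 1) {p : ℕ} (hp : 0 < p) {m : ℤ}
    (hgen : ∀ i j : ℕ, i + j = p → pieceSlope i j b ≠ 1) {x₀ x₁ : ℝ} (h01 : x₀ < x₁)
    (h₀ : x₀ + m < (linLift α b)^[p] x₀) (h₁ : (linLift α b)^[p] x₁ < x₁ + m) :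
    ((α : UnitAddCircle), b) ∈ hypSet := by
  have hcont := continuous_iterate_linLift_right α b p
  set g := (linLift α b)^[p] with hg
  set P := {y | y ∈ Icc x₀ x₁ ∧ y + m < g y} with hP
  have hne : P.Nonempty := ⟨x₀, ⟨le_rfl, h01.le⟩, h₀⟩
  have hbdd : BddAbove P := ⟨x₁, fun y hy => hy.1.2⟩
  set x := sSup P
  have hx0 : x₀ ≤ x := le_csSup hbdd ⟨⟨le_rfl, h01.le⟩, h₀⟩
  have hx1 : x ≤ x₁ := csSup_le hne fun y hy => hy.1.2
  have habove : ∀ y ∈ Ioc x x₁, g y ≤ y + m := fun y hy => by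
    by_contra! hcon
    exact absurd (le_csSup hbdd ⟨⟨hx0.trans hy.1.le, hy.2⟩, hcon⟩) (not_le.2 hy.1)
  have hge : x + m ≤ g x := by
    have hcl : IsClosed {y | y + m ≤ g y} := isClosed_le (by fun_prop) hcont
    exact closure_minimal (fun y hy => hy.2.le) hcl (csSup_mem_closure hne hbdd)
  have hx1' : x < x₁ := lt_of_le_of_ne hx1 fun e => by rw [e] at hge; linarith
  have hfix : g x = x + m := by
    refine le_antisymm ?_ hge
    have hcl : IsClosed {y | g y ≤ y + m} := isClosed_le hcont (by fun_prop)
    refine closure_minimal (s := Ioc x x₁) (fun y hy => habove y hy) hcl ?_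
    rw [closure_Ioc hx1'.ne]; exact ⟨le_rfl, hx1⟩
  obtain ⟨η₁, hη₁, i, j, hij, hr⟩ := iterate_linLift_affine_right (α := α) hb x p
  obtain ⟨η₂, hη₂, i', j', hij', hl⟩ := iterate_linLift_affine_left (α := α) hb x p
  rw [← hg] at hr hl
  have hs₁ : pieceSlope i j b < 1 := by
    refine lt_of_le_of_ne ?_ (hgen i j hij)
    have hpos : 0 < min η₁ (x₁ - x) := lt_min hη₁ (by linarith)
    have h1 := hr (x + min η₁ (x₁ - x)) ⟨by linarith, by linarith [min_le_left η₁ (x₁ - x)]⟩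
    have h2 := habove (x + min η₁ (x₁ - x))
      ⟨by linarith, by linarith [min_le_right η₁ (x₁ - x)]⟩
    rw [h1, hfix] at h2
    nlinarith
  have hs₂ : pieceSlope i' j' b < 1 := by
    obtain ⟨y, hy, hyx⟩ := exists_lt_of_lt_csSup hne (show x - η₂ < x by linarith)
    have hyx' : y ≤ x := le_csSup hbdd hy
    have h1 := hy.2
    rw [hl y ⟨hyx.le, hyx'⟩, hfix] at h1
    by_contra! hcon
    nlinarith
  refine mem_hypSet_of_contracts hb hp (lt_min hη₁ hη₂) hfix (fun y hy => ?_) fun y hy => ?_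
  · rw [← hg, hr y ⟨hy.1.le, by linarith [hy.2, min_le_left η₁ η₂]⟩, hfix]
    nlinarith [hy.1]
  · rw [← hg, hl y ⟨by linarith [hy.1, min_le_right η₁ η₂], hy.2.le⟩, hfix]
    nlinarith [hy.2]

lemma finite_setOf_pieceSlope_eq_one {p : ℕ} (hp : 0 < p) :
    {b : ℝ | ∃ i j : ℕ, i + j = p ∧ pieceSlope i j b = 1}.Finite := by
  classical
  let P : ℕ × ℕ → Polynomial ℝ := fun q =>
    (2 + 2 * Polynomial.X) ^ q.1 * (2 - 2 * Polynomial.X) ^ q.2 - 1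
  have hP : ∀ q ∈ Finset.HasAntidiagonal.antidiagonal p, P q ≠ 0 := fun q hq h0 => by
    have := congrArg (Polynomial.eval 0) h0
    simp only [P, Polynomial.eval_sub, Polynomial.eval_mul, Polynomial.eval_pow,
      Polynomial.eval_add, Polynomial.eval_ofNat, Polynomial.eval_X, Polynomial.eval_one,
      Polynomial.eval_zero, mul_zero, add_zero, sub_zero, ← pow_add,
      Finset.HasAntidiagonal.mem_antidiagonal.1 hq] at this
    have h2 : (1 : ℝ) < 2 ^ p := one_lt_pow₀ (by norm_num) hp.ne'
    linarith
  refine ((Finset.HasAntidiagonal.antidiagonal p).biUnion fun q => (P q).roots.toFinset).finite_toSet.subset ?_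
  rintro b ⟨i, j, hij, h⟩
  simp only [Finset.coe_biUnion, mem_iUnion, Finset.mem_coe, Multiset.mem_toFinset]
  refine ⟨(i, j), Finset.HasAntidiagonal.mem_antidiagonal.2 hij, ?_⟩
  rw [Polynomial.mem_roots (hP _ (Finset.HasAntidiagonal.mem_antidiagonal.2 hij))]
  simp only [P, Polynomial.IsRoot.def, Polynomial.eval_sub, Polynomial.eval_mul,
    Polynomial.eval_pow, Polynomial.eval_add, Polynomial.eval_ofNat, Polynomial.eval_X,
    Polynomial.eval_one]
  unfold pieceSlope at h
  linarith

/-- If the graph of some `F^p - m` crosses the diagonal downwards, the parameter is a limit of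
hyperbolic ones. -/
lemma mem_closure_hypSet_of_crossing {α b : ℝ} (hb : b ∈ Icc (0 : ℝ) 1) {p : ℕ} (hp : 0 < p)
    {m : ℤ} {x₀ x₁ : ℝ} (h01 : x₀ < x₁)
    (h₀ : x₀ + m < (linLift α b)^[p] x₀) (h₁ : (linLift α b)^[p] x₁ < x₁ + m) :
    ((α : UnitAddCircle), b) ∈ closure hypSet := by
  set B := {b : ℝ | ∃ i j : ℕ, i + j = p ∧ pieceSlope i j b = 1}
  have hmem : b ∈ closure (Ioo (0 : ℝ) 1 ∩ Bᶜ) := by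
    have h1 := ((finite_setOf_pieceSlope_eq_one hp).countable.dense_compl ℝ).open_subset_closure_inter
      (isOpen_Ioo (a := (0 : ℝ)) (b := 1))
    have h2 := closure_minimal h1 isClosed_closure
    rw [closure_Ioo (by norm_num)] at h2
    exact h2 hb
  have hc : ∀ x, Continuous fun b' => (linLift α b')^[p] x := fun x =>
    (continuous_iterate_linLift_param x p).comp (Continuous.prodMk continuous_const continuous_id)
  rw [mem_closure_iff_frequently] at hmem ⊢
  have hev : ∀ᶠ b' in 𝓝 b, x₀ + m < (linLift α b')^[p] x₀ ∧ (linLift α b')^[p] x₁ < x₁ + m :=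
    ((hc x₀).continuousAt.eventually (lt_mem_nhds h₀)).and
      ((hc x₁).continuousAt.eventually (gt_mem_nhds h₁))
  have hfr : ∃ᶠ b' in 𝓝 b, ((α : UnitAddCircle), b') ∈ hypSet := by
    refine (hmem.and_eventually hev).mono fun b' hb' => ?_
    exact mem_hypSet_of_crossing ⟨hb'.1.1.1.le, hb'.1.1.2⟩ hp
      (fun i j hij h => hb'.1.2 ⟨i, j, hij, h⟩) h01 hb'.2.1 hb'.2.2
  have ht : Tendsto (fun b' : ℝ => ((α : UnitAddCircle), b')) (𝓝 b) (𝓝 ((α : UnitAddCircle), b)) :=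
    (Continuous.prodMk continuous_const continuous_id).tendsto b
  exact ht.frequently hfr

lemma mem_closure_hypSet_of_forall {α b : ℝ}
    (h : ∀ ε > 0, ∃ α' b', |α' - α| < ε ∧ |b' - b| < ε ∧
      ((α' : UnitAddCircle), b') ∈ closure hypSet) :
    ((α : UnitAddCircle), b) ∈ closure hypSet := by
  rw [← closure_closure, mem_closure_iff_frequently]
  have ht : Tendsto (fun q : ℝ × ℝ => ((q.1 : UnitAddCircle), q.2)) (𝓝 (α, b))
      (𝓝 ((α : UnitAddCircle), b)) :=
    (Continuous.prodMk ((AddCircle.continuous_mk' 1).comp continuous_fst) continuous_snd).tendsto _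
  refine ht.frequently ?_
  rw [Metric.nhds_basis_ball.frequently_iff]
  intro ε hε
  obtain ⟨α', b', h1, h2, h3⟩ := h ε hε
  exact ⟨(α', b'), by simpa [Prod.dist_eq, Real.dist_eq] using ⟨h1, h2⟩, h3⟩

lemma linLift_eventually_affine {α b x : ℝ} (hx : ∀ k : ℤ, 2 * x ≠ k) :
    ∃ i j : ℕ, i + j = 1 ∧ ∃ A : ℝ × ℝ → ℝ, ∀ᶠ q : (ℝ × ℝ) × ℝ in 𝓝 ((α, b), x),
      linLift q.1.1 q.1.2 q.2 = A q.1 + pieceSlope i j q.1.2 * q.2 := by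
  have h1 := Int.floor_le x
  have h2 := Int.lt_floor_add_one x
  have h1' : (⌊x⌋ : ℝ) < x := lt_of_le_of_ne h1 fun e => hx (2 * ⌊x⌋) (by push_cast; linarith)
  have hsnd : Tendsto (fun q : (ℝ × ℝ) × ℝ => q.2) (𝓝 ((α, b), x)) (𝓝 x) :=
    continuous_snd.tendsto _
  rcases lt_or_ge x (⌊x⌋ + 1 / 2) with h | h
  · refine ⟨1, 0, rfl, fun q => q.1 + q.2 / 2 * (-4 * ⌊x⌋ - 1), ?_⟩
    filter_upwards [hsnd.eventually (Ioo_mem_nhds h1' h)] with q hq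
    simp only [linLift, pieceSlope, triWave_left hq.1.le hq.2.le]
    ring
  · have h' : (⌊x⌋ : ℝ) + 1 / 2 < x :=
      lt_of_le_of_ne h fun e => hx (2 * ⌊x⌋ + 1) (by push_cast; linarith)
    refine ⟨0, 1, rfl, fun q => q.1 + q.2 / 2 * (3 + 4 * ⌊x⌋), ?_⟩
    filter_upwards [hsnd.eventually (Ioo_mem_nhds h' h2)] with q hq
    simp only [linLift, pieceSlope, triWave_right hq.1.le hq.2.le]
    ring

lemma iterate_linLift_eventually_affine {α b x : ℝ} {p : ℕ}
    (hx : ∀ n < p, ∀ k : ℤ, 2 * (linLift α b)^[n] x ≠ k) :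
    ∃ i j : ℕ, i + j = p ∧ ∃ A : ℝ × ℝ → ℝ, ∀ᶠ q : (ℝ × ℝ) × ℝ in 𝓝 ((α, b), x),
      (linLift q.1.1 q.1.2)^[p] q.2 = A q.1 + pieceSlope i j q.1.2 * q.2 := by
  induction p with
  | zero => exact ⟨0, 0, rfl, fun _ => 0, .of_forall fun q => by simp [pieceSlope]⟩
  | succ p ih =>
    obtain ⟨i, j, hij, A, hA⟩ := ih fun n hn => hx n (by omega)
    obtain ⟨i', j', hij', A', hA'⟩ := linLift_eventually_affine (α := α) (b := b) (hx p (by omega))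
    have ht : Tendsto (fun q : (ℝ × ℝ) × ℝ => (q.1, (linLift q.1.1 q.1.2)^[p] q.2))
        (𝓝 ((α, b), x)) (𝓝 ((α, b), (linLift α b)^[p] x)) :=
      (continuous_fst.prodMk (continuous_iterate_linLift p)).tendsto ((α, b), x)
    refine ⟨i' + i, j' + j, by omega, fun q => A' q + pieceSlope i' j' q.2 * A q, ?_⟩
    filter_upwards [hA, ht.eventually hA'] with q h1 h2
    rw [Function.iterate_succ_apply']
    rw [h2, h1, ← pieceSlope_mul]
    ring

/-- On every open interval there are points whose first `p` iterates avoid the break points. -/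
lemma exists_iterate_avoids_breaks {α b : ℝ} (hb : b ∈ Ico (0 : ℝ) 1) {x₀ x₁ : ℝ} (h : x₀ < x₁) :
    ∃ x ∈ Ioo x₀ x₁, ∀ (n : ℕ) (k : ℤ), 2 * (linLift α b)^[n] x ≠ k := by
  have hcount : {x : ℝ | ∃ (n : ℕ) (k : ℤ), 2 * (linLift α b)^[n] x = k}.Countable := by
    simp only [ofPred_exists]
    refine countable_iUnion fun n => countable_iUnion fun k => Subsingleton.countable ?_
    intro x hx y hy
    refine ((strictMono_linLift (α := α) hb).iterate n).injective ?_
    simp only [mem_ofPred_eq] at hx hy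
    linarith
  obtain ⟨x, hx, hx'⟩ := (hcount.dense_compl ℝ).exists_between h
  exact ⟨x, hx', fun n k e => hx ⟨n, k, e⟩⟩

lemma exists_pieceSlope_lt_one {i j : ℕ} (hij : 0 < i + j) {b : ℝ} (hb : b ∈ Ico (0 : ℝ) 1)
    (h : pieceSlope i j b = 1) {ε : ℝ} (hε : 0 < ε) :
    ∃ b' ∈ Ico (0 : ℝ) 1, |b' - b| < ε ∧ pieceSlope i j b' < 1 := by
  have hb0 : 0 < b := lt_of_le_of_ne hb.1 fun e => by
    rw [← e] at h
    simp only [pieceSlope, mul_zero, add_zero, sub_zero, ← pow_add] at h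
    have h2 : (1 : ℝ) < 2 ^ (i + j) := one_lt_pow₀ (by norm_num) hij.ne'
    linarith
  have hb1 := hb.2
  obtain ⟨δ, hδ, hδ'⟩ : ∃ δ > 0, δ < min ε (min b (1 - b)) :=
    exists_between (lt_min hε (lt_min hb0 (by linarith)))
  simp only [lt_min_iff] at hδ'
  by_contra! hcon
  have h1 := hcon (b + δ) ⟨by linarith, by linarith⟩ (by simpa [abs_of_pos hδ] using hδ'.1)
  have h2 := hcon (b - δ) ⟨by linarith, by linarith⟩ (by simpa [abs_of_pos hδ] using hδ'.1)
  have e1 : pieceSlope i j (b + δ) * pieceSlope i j (b - δ) =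
      ((2 + 2 * (b + δ)) * (2 + 2 * (b - δ))) ^ i * ((2 - 2 * (b + δ)) * (2 - 2 * (b - δ))) ^ j := by
    unfold pieceSlope; rw [mul_pow, mul_pow]; ring
  have e2 : ((2 + 2 * b) ^ 2) ^ i * ((2 - 2 * b) ^ 2) ^ j = 1 := by
    rw [← pow_mul, ← pow_mul, mul_comm 2 i, mul_comm 2 j, pow_mul, pow_mul, ← mul_pow]
    unfold pieceSlope at h; rw [h, one_pow]
  have p1 : 0 < (2 + 2 * (b + δ)) * (2 + 2 * (b - δ)) := by
    apply mul_pos <;> linarith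
  have p2 : 0 < (2 - 2 * (b + δ)) * (2 - 2 * (b - δ)) := by
    apply mul_pos <;> linarith
  have l1 : (2 + 2 * (b + δ)) * (2 + 2 * (b - δ)) < (2 + 2 * b) ^ 2 := by nlinarith
  have l2 : (2 - 2 * (b + δ)) * (2 - 2 * (b - δ)) < (2 - 2 * b) ^ 2 := by nlinarith
  have : ((2 + 2 * (b + δ)) * (2 + 2 * (b - δ))) ^ i * ((2 - 2 * (b + δ)) * (2 - 2 * (b - δ))) ^ j
      < ((2 + 2 * b) ^ 2) ^ i * ((2 - 2 * b) ^ 2) ^ j := by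
    rcases Nat.eq_zero_or_pos i with rfl | hi
    · simpa using pow_lt_pow_left₀ l2 p2.le (by omega)
    · exact mul_lt_mul (pow_lt_pow_left₀ l1 p1.le hi.ne') (pow_le_pow_left₀ p2.le l2.le j)
        (pow_pos p2 j) (by positivity)
  nlinarith

/-- Solving `F_{α',b}^p x = y` for `α'` close to `α`. -/
lemma exists_param_iterate_eq {α b : ℝ} (hb : b ∈ Icc (0 : ℝ) 1) {p : ℕ} (hp : 0 < p) (x y : ℝ) :
    ∃ α', |α' - α| ≤ |(linLift α b)^[p] x - y| ∧ (linLift α' b)^[p] x = y ∧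
      (y ≤ (linLift α b)^[p] x → α' ≤ α) := by
  have hc : Continuous fun a => (linLift a b)^[p] x :=
    (continuous_iterate_linLift_param x p).comp (Continuous.prodMk continuous_id continuous_const)
  set d := (linLift α b)^[p] x - y with hd
  rcases le_total 0 d with h | h
  · have h1 := iterate_linLift_add_le hb (show α - d ≤ α by linarith) x hp
    obtain ⟨α', hα', e⟩ := intermediate_value_Icc (show α - d ≤ α by linarith) hc.continuousOn
      (show y ∈ Icc _ _ from ⟨by linarith, by linarith⟩)
    refine ⟨α', ?_, e, fun _ => hα'.2⟩
    rw [abs_of_nonneg h, abs_of_nonpos (by linarith [hα'.2])]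
    linarith [hα'.1]
  · have h1 := iterate_linLift_add_le hb (show α ≤ α - d by linarith) x hp
    obtain ⟨α', hα', e⟩ := intermediate_value_Icc (show α ≤ α - d by linarith) hc.continuousOn
      (show y ∈ Icc _ _ from ⟨by linarith, by linarith⟩)
    refine ⟨α', ?_, e, fun hy => ?_⟩
    · rw [abs_of_nonpos h, abs_of_nonneg (by linarith [hα'.1])]
      linarith [hα'.2]
    · linarith [hα'.2]

/-- If some `F^p - m` has two fixed points, the parameter is a limit of hyperbolic ones. -/
lemma mem_closure_hypSet_of_fixed_fixed {α b : ℝ} (hb : b ∈ Ico (0 : ℝ) 1) {p : ℕ} (hp : 0 < p)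
    {m : ℤ} {x₀ x₁ : ℝ} (h01 : x₀ < x₁)
    (h₀ : (linLift α b)^[p] x₀ = x₀ + m) (h₁ : (linLift α b)^[p] x₁ = x₁ + m) :
    ((α : UnitAddCircle), b) ∈ closure hypSet := by
  have hb' : b ∈ Icc (0 : ℝ) 1 := ⟨hb.1, hb.2.le⟩
  have hc : ∀ x, Continuous fun a => (linLift a b)^[p] x := fun x =>
    (continuous_iterate_linLift_param x p).comp (Continuous.prodMk continuous_id continuous_const)
  by_cases hid : ∀ x ∈ Ioo x₀ x₁, (linLift α b)^[p] x = x + m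
  · obtain ⟨x, hx, hbr⟩ := exists_iterate_avoids_breaks (α := α) hb h01
    obtain ⟨i, j, hij, A, hA⟩ := iterate_linLift_eventually_affine (p := p) fun n _ k => hbr n k
    have hA' := hA.curry_nhds
    have hslope : pieceSlope i j b = 1 := by
      have h1 := (hA'.self_of_nhds.filter_mono (nhdsWithin_le_nhds (s := Ioi x))).and
        (Ioo_mem_nhdsGT hx.2)
      obtain ⟨y, hy, hy'⟩ := h1.exists
      have hy2 := hid y ⟨hx.1.trans hy'.1, hy'.2⟩
      have hx2 := hid x hx
      have hx3 := hA'.self_of_nhds.self_of_nhds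
      simp only at hy hx3
      rw [hy2] at hy
      rw [hx2] at hx3
      have : (pieceSlope i j b - 1) * (y - x) = 0 := by linarith
      rcases mul_eq_zero.1 this with h | h
      · linarith
      · linarith [hy'.1]
    refine mem_closure_hypSet_of_forall fun ε hε => ?_
    obtain ⟨δ, hδ, hball⟩ := Metric.eventually_nhds_iff.1 hA'
    have hcb : ContinuousAt (fun b' => (linLift α b')^[p] x) b :=
      ((continuous_iterate_linLift_param x p).comp
        (Continuous.prodMk continuous_const continuous_id)).continuousAt
    obtain ⟨δ', hδ', hcb'⟩ := Metric.continuousAt_iff.1 hcb (min ε δ) (lt_min hε hδ)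
    obtain ⟨b₁, hb₁, hbb, hlt⟩ := exists_pieceSlope_lt_one (by omega) hb hslope
      (lt_min hδ' (lt_min hε hδ))
    simp only [lt_min_iff] at hbb
    obtain ⟨α₁, hα₁, hfix, -⟩ :=
      exists_param_iterate_eq (α := α) ⟨hb₁.1, hb₁.2.le⟩ hp x (x + m)
    have hα₂ : |α₁ - α| < min ε δ := by
      refine hα₁.trans_lt ?_
      have := hcb' (x := b₁) (by simpa [Real.dist_eq] using hbb.1)
      rwa [Real.dist_eq, hid x hx] at this
    simp only [lt_min_iff] at hα₂
    refine ⟨α₁, b₁, hα₂.1, hbb.2.1, ?_⟩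
    have hq : ∀ᶠ y in 𝓝 x, (linLift α₁ b₁)^[p] y = A (α₁, b₁) + pieceSlope i j b₁ * y :=
      hball (y := (α₁, b₁)) (by simpa [Prod.dist_eq, Real.dist_eq] using ⟨hα₂.2, hbb.2.2⟩)
    have hx3 := hq.self_of_nhds
    rw [hfix] at hx3
    obtain ⟨y₀, hy₀, hy₀'⟩ := ((hq.filter_mono (nhdsWithin_le_nhds (s := Iio x))).and
      self_mem_nhdsWithin).exists
    obtain ⟨y₁, hy₁, hy₁'⟩ := ((hq.filter_mono (nhdsWithin_le_nhds (s := Ioi x))).and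
      self_mem_nhdsWithin).exists
    refine mem_closure_hypSet_of_crossing ⟨hb₁.1, hb₁.2.le⟩ hp (hy₀'.trans hy₁') (m := m) ?_ ?_
    · rw [hy₀]; nlinarith
    · rw [hy₁]; nlinarith
  · push Not at hid
    obtain ⟨x, hx, hne⟩ := hid
    refine mem_closure_hypSet_of_forall fun ε hε => ?_
    rcases lt_or_gt_of_ne hne with h | h
    · have ev : ∀ᶠ a in 𝓝[>] α, (linLift a b)^[p] x < x + m :=
        ((hc x).continuousAt.eventually (gt_mem_nhds h)).filter_mono nhdsWithin_le_nhds
      obtain ⟨a, ha, ha'⟩ := (ev.and (Ioo_mem_nhdsGT (show α < α + ε by linarith))).exists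
      refine ⟨a, b, ?_, by simpa using hε, ?_⟩
      · rw [abs_of_pos (by linarith [ha'.1])]; linarith [ha'.2]
      · refine mem_closure_hypSet_of_crossing hb' hp hx.1 (m := m) ?_ ha
        linarith [iterate_linLift_add_le hb' ha'.1.le x₀ hp, ha'.1]
    · have ev : ∀ᶠ a in 𝓝[<] α, x + m < (linLift a b)^[p] x :=
        ((hc x).continuousAt.eventually (lt_mem_nhds h)).filter_mono nhdsWithin_le_nhds
      obtain ⟨a, ha, ha'⟩ := (ev.and (Ioo_mem_nhdsLT (show α - ε < α by linarith))).exists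
      refine ⟨a, b, ?_, by simpa using hε, ?_⟩
      · rw [abs_of_neg (by linarith [ha'.2])]; linarith [ha'.1]
      · refine mem_closure_hypSet_of_crossing hb' hp hx.2 (m := m) ha ?_
        linarith [iterate_linLift_add_le hb' ha'.2.le x₁ hp, ha'.2]

/-- Every parameter with `b = 1` is a limit of hyperbolic ones. -/
lemma mem_closure_hypSet_one (α : ℝ) : ((α : UnitAddCircle), (1 : ℝ)) ∈ closure hypSet := by
  have h1 : (1 : ℝ) ∈ Icc (0 : ℝ) 1 := by simp
  refine mem_closure_hypSet_of_forall fun ε hε => ?_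
  by_contra! hcon
  have hc : ∀ n, Continuous fun a => (linLift a 1)^[n] (1 / 2) := fun n =>
    (continuous_iterate_linLift_param (1 / 2) n).comp
      (Continuous.prodMk continuous_id continuous_const)
  have hflat : ∀ a, linLift a 1 1 = linLift a 1 (1 / 2) := fun a => by
    unfold linLift
    rw [triWave_right (k := 0) (x := 1) (by norm_num) (by norm_num),
      triWave_right (k := 0) (x := 1 / 2) (by norm_num) (by norm_num)]
    push_cast; ring
  have avoid : ∀ a ∈ Icc α (α + ε / 2), ∀ n, ∀ k : ℤ,
      (linLift a 1)^[n + 1] (1 / 2) ∉ Ioo ((k : ℝ) + 1 / 2) (k + 1) := fun a ha n k hk => by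
    refine hcon a 1 (by rw [abs_of_nonneg (by linarith [ha.1])]; linarith [ha.2]) (by simpa using hε)
      (mem_closure_hypSet_of_crossing h1 n.succ_pos (m := k) (x₀ := 1 / 2) (x₁ := 1)
        (by norm_num) (by linarith [hk.1]) ?_)
    rw [Function.iterate_succ_apply, hflat, ← Function.iterate_succ_apply]
    linarith [hk.2]
  set d : ℕ → ℝ := fun n =>
    (linLift (α + ε / 2) 1)^[n + 1] (1 / 2) - (linLift α 1)^[n + 1] (1 / 2) with hd
  have hd0 : ∀ n, ε / 2 ≤ d n := fun n => by
    have := iterate_linLift_add_le h1 (show α ≤ α + ε / 2 by linarith) (1 / 2) n.succ_pos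
    simp only [hd]; linarith
  have same : ∀ n, ∃ k : ℤ, (linLift α 1)^[n + 1] (1 / 2) ∈ Icc (k : ℝ) (k + 1 / 2) ∧
      (linLift (α + ε / 2) 1)^[n + 1] (1 / 2) ∈ Icc (k : ℝ) (k + 1 / 2) := fun n => by
    set c := (linLift α 1)^[n + 1] (1 / 2)
    set c' := (linLift (α + ε / 2) 1)^[n + 1] (1 / 2)
    have hcc : c ≤ c' := by have := hd0 n; simp only [hd] at this; linarith
    have hfill : ∀ z ∈ Icc c c', ∀ k : ℤ, z ∉ Ioo ((k : ℝ) + 1 / 2) (k + 1) := fun z hz => by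
      obtain ⟨a, ha, rfl⟩ := intermediate_value_Icc (show α ≤ α + ε / 2 by linarith)
        (hc (n + 1)).continuousOn hz
      exact avoid a ha n
    have f1 := Int.floor_le c
    have f2 := Int.lt_floor_add_one c
    have f3 : c ≤ ⌊c⌋ + 1 / 2 := by
      by_contra! h
      exact hfill c ⟨le_rfl, hcc⟩ ⌊c⌋ ⟨h, f2⟩
    refine ⟨⌊c⌋, ⟨f1, f3⟩, f1.trans hcc, ?_⟩
    by_contra! h
    rcases lt_or_ge c' (⌊c⌋ + 1) with h' | h'
    · exact hfill c' ⟨hcc, le_rfl⟩ ⌊c⌋ ⟨h, h'⟩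
    · exact hfill (⌊c⌋ + 3 / 4) ⟨by linarith, by linarith⟩ ⌊c⌋ ⟨by linarith, by linarith⟩
  have grow : ∀ n, 4 * d n ≤ d (n + 1) := fun n => by
    obtain ⟨k, h, h'⟩ := same n
    simp only [hd, Function.iterate_succ_apply' _ (n + 1)]
    set c := (linLift α 1)^[n + 1] (1 / 2)
    set c' := (linLift (α + ε / 2) 1)^[n + 1] (1 / 2)
    simp only [linLift, triWave_left h.1 h.2, triWave_left h'.1 h'.2]
    linarith
  have pw : ∀ n, 4 ^ n * (ε / 2) ≤ d n := fun n => by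
    induction n with
    | zero => simpa using hd0 0
    | succ n ih => rw [pow_succ]; linarith [grow n]
  obtain ⟨n, hn⟩ := pow_unbounded_of_one_lt (1 / ε) (show (1 : ℝ) < 4 by norm_num)
  rw [div_lt_iff₀ hε] at hn
  obtain ⟨k, h, h'⟩ := same n
  have := pw n
  simp only [hd] at this
  linarith [h.1, h'.2]

/-- On the arc from the left end of an interval free of break points to the next integer, `F`
stretches by at most its stretching factor on that interval. -/
lemma linLift_stretch {α β b s t y z : ℝ} {k : ℤ} (hb : 0 ≤ b) (hst : s < t)
    (hfree : ∀ m : ℤ, ∀ x ∈ Icc s t, 2 * x ≠ m) (hs : (k : ℝ) < s) (ht : t < k + 1)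
    (hy : s ≤ y) (hyz : y ≤ z) (hz : z ≤ k + 1) :
    (t - s) * (linLift β b z - linLift β b y) ≤
      (linLift α b t - linLift α b s) * (z - y) := by
  rcases lt_or_ge t (k + 1 / 2) with h | h
  · have e : linLift α b t - linLift α b s = (2 + 2 * b) * (t - s) := by
      simp only [linLift, triWave_left (hs.le.trans hst.le) h.le,
        triWave_left hs.le (hst.le.trans h.le)]
      ring
    have := linLift_sub_le (α := β) hb hyz
    rw [e]
    nlinarith [sub_pos.2 hst]
  · have hs' : (k : ℝ) + 1 / 2 ≤ s := by
      by_contra! hcon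
      exact hfree (2 * k + 1) (k + 1 / 2) ⟨hcon.le, h⟩ (by push_cast; ring)
    have e : linLift α b t - linLift α b s = (2 - 2 * b) * (t - s) := by
      simp only [linLift, triWave_right h ht.le,
        triWave_right hs' (hst.le.trans ht.le)]
      ring
    have e' : linLift β b z - linLift β b y = (2 - 2 * b) * (z - y) := by
      simp only [linLift, triWave_right (hs'.trans (hy.trans hyz)) hz,
        triWave_right (hs'.trans hy) (hyz.trans hz)]
      ring
    rw [e, e']
    linarith [mul_comm (t - s) ((2 - 2 * b) * (z - y))]

/-- `Φ` stays within bounded distance of the rescaled iterates of the lift. -/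
lemma abs_iterate_linLift_sub_limUnder_le {α b : ℝ} (hb : b ∈ Icc (0 : ℝ) 1) (n : ℕ) (x : ℝ) :
    |(linLift α b)^[n] x - 2 ^ n * limUnder atTop (fun n : ℕ => (linLift α b)^[n] x / 2 ^ n)| ≤
      |α| + 1 / 2 := by
  set C := |α| + 1 / 2 with hC
  have step : ∀ y, |linLift α b y - 2 * y| ≤ C := fun y => by
    have h1 := abs_triWave_le y
    have h2 : linLift α b y - 2 * y = α + b / 2 * triWave y := by unfold linLift; ring
    rw [h2]
    refine (abs_add_le _ _).trans (add_le_add le_rfl ?_)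
    rw [abs_mul, abs_of_nonneg (by linarith [hb.1])]
    nlinarith [hb.1, hb.2, abs_nonneg (triWave y)]
  set u : ℕ → ℝ := fun n => (linLift α b)^[n] x / 2 ^ n with hu
  have hdist : ∀ n, dist (u n) (u (n + 1)) ≤ C / 2 / 2 ^ n := fun n => by
    rw [Real.dist_eq, abs_sub_comm]
    simp only [hu]
    rw [Function.iterate_succ_apply', pow_succ]
    have h2 : (0 : ℝ) < 2 ^ n := by positivity
    have : linLift α b ((linLift α b)^[n] x) / (2 ^ n * 2) - (linLift α b)^[n] x / 2 ^ n =
        (linLift α b ((linLift α b)^[n] x) - 2 * (linLift α b)^[n] x) / 2 / 2 ^ n := by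
      field_simp
    rw [this, abs_div, abs_div, abs_of_pos h2, abs_two]
    gcongr
    exact step _
  have hcauchy : CauchySeq u := cauchySeq_of_le_geometric_two hdist
  have hlim := hcauchy.tendsto_limUnder
  have := dist_le_of_le_geometric_two_of_tendsto hdist hlim n
  rw [Real.dist_eq] at this
  have h2 : (0 : ℝ) < 2 ^ n := by positivity
  have e : (linLift α b)^[n] x - 2 ^ n * limUnder atTop u = 2 ^ n * (u n - limUnder atTop u) := by
    simp only [hu]; field_simp
  rw [e, abs_mul, abs_of_pos h2]
  rw [le_div_iff₀ h2] at this
  linarith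

/-- The rescaled limit `lim F^n(x) / 2^n` for `F = linLift α b`. -/
noncomputable def linLiftLim (α b x : ℝ) : ℝ :=
  limUnder atTop (fun n : ℕ => (linLift α b)^[n] x / 2 ^ n)

lemma abs_iterate_linLift_sub_le {α b : ℝ} (hb : b ∈ Icc (0 : ℝ) 1) (n : ℕ) (x : ℝ) :
    |(linLift α b)^[n] x - 2 ^ n * linLiftLim α b x| ≤ |α| + 1 / 2 :=
  abs_iterate_linLift_sub_limUnder_le hb n x

lemma eq_of_two_pow_mul_le {x y D : ℝ} (h : ∀ n : ℕ, 2 ^ n * |x - y| ≤ D) : x = y := by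
  by_contra hne
  have hpos : 0 < |x - y| := abs_pos.2 (sub_ne_zero.2 hne)
  obtain ⟨n, hn⟩ := pow_unbounded_of_one_lt (D / |x - y|) (one_lt_two : (1 : ℝ) < 2)
  rw [div_lt_iff₀ hpos] at hn
  linarith [h n]

lemma linLiftLim_eq_of_bounded {α b x c D : ℝ} (hb : b ∈ Icc (0 : ℝ) 1)
    (h : ∀ n : ℕ, |(linLift α b)^[n] x - 2 ^ n * c| ≤ D) : linLiftLim α b x = c := by
  refine eq_of_two_pow_mul_le (D := |α| + 1 / 2 + D) fun n => ?_
  have h1 := abs_le.1 (abs_iterate_linLift_sub_le (α := α) hb n x)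
  have h2 := abs_le.1 (h n)
  rw [← abs_of_pos (show (0 : ℝ) < 2 ^ n by positivity), ← abs_mul, mul_sub]
  exact abs_le.2 ⟨by linarith, by linarith⟩

lemma linLiftLim_iterate {α b : ℝ} (hb : b ∈ Icc (0 : ℝ) 1) (n : ℕ) (x : ℝ) :
    linLiftLim α b ((linLift α b)^[n] x) = 2 ^ n * linLiftLim α b x := by
  refine linLiftLim_eq_of_bounded hb (D := |α| + 1 / 2) fun m => ?_
  rw [← Function.iterate_add_apply, ← mul_assoc, ← pow_add]
  exact abs_iterate_linLift_sub_le hb _ x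

lemma linLiftLim_linLift {α b : ℝ} (hb : b ∈ Icc (0 : ℝ) 1) (x : ℝ) :
    linLiftLim α b (linLift α b x) = 2 * linLiftLim α b x := by
  simpa using linLiftLim_iterate (α := α) hb 1 x

lemma linLiftLim_add_int {α b : ℝ} (hb : b ∈ Icc (0 : ℝ) 1) (x : ℝ) (k : ℤ) :
    linLiftLim α b (x + k) = linLiftLim α b x + k := by
  refine linLiftLim_eq_of_bounded hb (D := |α| + 1 / 2) fun n => ?_
  have e : (linLift α b)^[n] (x + k) - 2 ^ n * (linLiftLim α b x + k)
      = (linLift α b)^[n] x - 2 ^ n * linLiftLim α b x := by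
    rw [iterate_linLift_add_int]; push_cast; ring
  rw [e]
  exact abs_iterate_linLift_sub_le hb n x

lemma linLiftLim_congr {α b x y D : ℝ} (hb : b ∈ Icc (0 : ℝ) 1)
    (h : ∀ n : ℕ, |(linLift α b)^[n] x - (linLift α b)^[n] y| ≤ D) :
    linLiftLim α b x = linLiftLim α b y := by
  refine linLiftLim_eq_of_bounded hb (D := D + (|α| + 1 / 2)) fun n => ?_
  have h1 := abs_le.1 (h n)
  have h2 := abs_le.1 (abs_iterate_linLift_sub_le (α := α) hb n y)
  exact abs_le.2 ⟨by linarith, by linarith⟩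

lemma monotone_linLiftLim {α b : ℝ} (hb : b ∈ Icc (0 : ℝ) 1) : Monotone (linLiftLim α b) := by
  intro x y hxy
  by_contra! hlt
  refine hlt.ne' (eq_of_two_pow_mul_le (D := 2 * (|α| + 1 / 2)) fun n => ?_)
  have h1 := abs_le.1 (abs_iterate_linLift_sub_le (α := α) hb n x)
  have h2 := abs_le.1 (abs_iterate_linLift_sub_le (α := α) hb n y)
  have h3 := (monotone_linLift (α := α) hb).iterate n hxy
  rw [abs_of_pos (sub_pos.2 hlt), mul_sub]
  linarith

lemma isClosed_linLiftLim_eq {α b : ℝ} (hb : b ∈ Icc (0 : ℝ) 1) (c : ℝ) :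
    IsClosed {x | linLiftLim α b x = c} := by
  have : {x | linLiftLim α b x = c}
      = ⋂ n : ℕ, {x | |(linLift α b)^[n] x - 2 ^ n * c| ≤ |α| + 1 / 2} := by
    ext x
    rw [mem_iInter]
    refine ⟨fun h n => ?_, fun h => linLiftLim_eq_of_bounded hb h⟩
    have := abs_iterate_linLift_sub_le (α := α) hb n x
    rwa [show linLiftLim α b x = c from h] at this
  rw [this]
  refine isClosed_iInter fun n => isClosed_le ?_ continuous_const
  exact ((continuous_iterate_linLift_right α b n).sub continuous_const).abs

/-- `[s, t]` is a nondegenerate maximal interval on which `linLiftLim α b` is constant. -/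
def IsPlateau (α b s t : ℝ) : Prop :=
  s < t ∧ linLiftLim α b s = linLiftLim α b t ∧
    ∀ x, linLiftLim α b x = linLiftLim α b s → x ∈ Icc s t

lemma exists_isPlateau {α b x y : ℝ} (hb : b ∈ Icc (0 : ℝ) 1) (hxy : x < y)
    (h : linLiftLim α b x = linLiftLim α b y) : ∃ s t, IsPlateau α b s t := by
  set S := {z | linLiftLim α b z = linLiftLim α b x} with hS
  have hcl : IsClosed S := isClosed_linLiftLim_eq hb _
  have hbd : S ⊆ Icc (linLiftLim α b x - (|α| + 1 / 2)) (linLiftLim α b x + (|α| + 1 / 2)) := by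
    intro z hz
    have h1 := abs_le.1 (abs_iterate_linLift_sub_le (α := α) hb 0 z)
    rw [show linLiftLim α b z = linLiftLim α b x from hz] at h1
    simp only [Function.iterate_zero, id, pow_zero, one_mul] at h1
    exact ⟨by linarith, by linarith⟩
  have hx : x ∈ S := rfl
  have hy : y ∈ S := h.symm
  have hne : S.Nonempty := ⟨x, hx⟩
  have hbb : BddBelow S := bddBelow_Icc.mono hbd
  have hba : BddAbove S := bddAbove_Icc.mono hbd
  have hs : linLiftLim α b (sInf S) = linLiftLim α b x := hcl.csInf_mem hne hbb
  have ht : linLiftLim α b (sSup S) = linLiftLim α b x := hcl.csSup_mem hne hba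
  refine ⟨sInf S, sSup S, ?_, hs.trans ht.symm, fun z hz => ?_⟩
  · linarith [csInf_le hbb hx, le_csSup hba hy]
  · have : z ∈ S := hz.trans hs
    exact ⟨csInf_le hbb this, le_csSup hba this⟩

namespace IsPlateau

variable {α b s t s' t' x : ℝ}

lemma lim_eq (h : IsPlateau α b s t) (hb : b ∈ Icc (0 : ℝ) 1) (hx : x ∈ Icc s t) :
    linLiftLim α b x = linLiftLim α b s :=
  le_antisymm (h.2.1 ▸ monotone_linLiftLim hb hx.2) (monotone_linLiftLim hb hx.1)

lemma map (h : IsPlateau α b s t) (hb : b ∈ Ico (0 : ℝ) 1) :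
    IsPlateau α b (linLift α b s) (linLift α b t) := by
  have hb' : b ∈ Icc (0 : ℝ) 1 := ⟨hb.1, hb.2.le⟩
  have hm := strictMono_linLift (α := α) hb
  refine ⟨hm h.1, by rw [linLiftLim_linLift hb', linLiftLim_linLift hb', h.2.1], fun x hx => ?_⟩
  obtain ⟨y, rfl⟩ := surjective_linLift (α := α) hb' x
  rw [linLiftLim_linLift hb', linLiftLim_linLift hb'] at hx
  have := h.2.2 y (by linarith)
  exact ⟨hm.monotone this.1, hm.monotone this.2⟩

lemma iterate (h : IsPlateau α b s t) (hb : b ∈ Ico (0 : ℝ) 1) (n : ℕ) :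
    IsPlateau α b ((linLift α b)^[n] s) ((linLift α b)^[n] t) := by
  induction n with
  | zero => exact h
  | succ n ih =>
    rw [Function.iterate_succ_apply', Function.iterate_succ_apply']
    exact ih.map hb

lemma add_int (h : IsPlateau α b s t) (hb : b ∈ Icc (0 : ℝ) 1) (k : ℤ) :
    IsPlateau α b (s + k) (t + k) := by
  refine ⟨by linarith [h.1], by simp [linLiftLim_add_int hb, h.2.1], fun x hx => ?_⟩
  have := h.2.2 (x + (-k : ℤ)) (by rw [linLiftLim_add_int hb, hx, linLiftLim_add_int hb]; simp)
  push_cast at this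
  exact ⟨by linarith [this.1], by linarith [this.2]⟩

lemma eq_of_mem (h : IsPlateau α b s t) (h' : IsPlateau α b s' t') (hb : b ∈ Icc (0 : ℝ) 1)
    (hx : x ∈ Icc s t) (hx' : x ∈ Icc s' t') : s = s' ∧ t = t' := by
  have e : linLiftLim α b s = linLiftLim α b s' := (h.lim_eq hb hx).symm.trans (h'.lim_eq hb hx')
  have h1 := h.2.2 s' e.symm
  have h2 := h.2.2 t' (h'.2.1.symm.trans e.symm)
  have h3 := h'.2.2 s e
  have h4 := h'.2.2 t (h.2.1.symm.trans e)
  exact ⟨le_antisymm h1.1 h3.1, le_antisymm h4.2 h2.2⟩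

lemma mem_closure_hypSet_of_overlap (h : IsPlateau α b s t) (hb : b ∈ Ico (0 : ℝ) 1) {i j : ℕ}
    (hij : i < j) {k : ℤ}
    (hx : x ∈ Icc ((linLift α b)^[i] s) ((linLift α b)^[i] t))
    (hxk : x + k ∈ Icc ((linLift α b)^[j] s) ((linLift α b)^[j] t)) :
    ((α : UnitAddCircle), b) ∈ closure hypSet := by
  have hb' : b ∈ Icc (0 : ℝ) 1 := ⟨hb.1, hb.2.le⟩
  obtain ⟨h1, h2⟩ := (h.iterate hb j).eq_of_mem ((h.iterate hb i).add_int hb' k) hb' hxk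
    ⟨by linarith [hx.1], by linarith [hx.2]⟩
  obtain ⟨p, rfl⟩ := Nat.exists_eq_add_of_lt hij
  rw [show i + p + 1 = (p + 1) + i by ring, Function.iterate_add_apply] at h1 h2
  exact mem_closure_hypSet_of_fixed_fixed hb p.succ_pos (h.iterate hb i).1 h1 h2

end IsPlateau

/-- Among intervals that are pairwise disjoint modulo `ℤ`, only finitely many contain a point of
`(1/M) ℤ`. -/
lemma finite_setOf_exists_div_mem {M : ℕ} (hM : 0 < M) {σ τ : ℕ → ℝ}
    (hdis : ∀ i j : ℕ, i < j → ∀ (k : ℤ) (x : ℝ), x ∈ Icc (σ i) (τ i) → x + k ∉ Icc (σ j) (τ j)) :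
    {n : ℕ | ∃ a : ℤ, (a : ℝ) / M ∈ Icc (σ n) (τ n)}.Finite := by
  have hM' : (0 : ℝ) < M := by exact_mod_cast hM
  have hMz : (0 : ℤ) < M := by exact_mod_cast hM
  choose! f hf using fun (n : ℕ) (hn : ∃ a : ℤ, (a : ℝ) / M ∈ Icc (σ n) (τ n)) => hn
  refine Finite.of_finite_image ((finite_Ico (0 : ℤ) M).subset ?_)
    (f := fun n => f n % (M : ℤ)) ?_
  · rintro _ ⟨n, -, rfl⟩
    exact ⟨Int.emod_nonneg _ hMz.ne', Int.emod_lt_of_pos _ hMz⟩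
  · have key : ∀ i j, i < j → (∃ a : ℤ, (a : ℝ) / M ∈ Icc (σ i) (τ i)) →
        (∃ a : ℤ, (a : ℝ) / M ∈ Icc (σ j) (τ j)) → f i % (M : ℤ) ≠ f j % (M : ℤ) := by
      intro i j hij hi hj e
      obtain ⟨k, hk⟩ := Int.ModEq.dvd (show f i ≡ f j [ZMOD M] from e)
      refine hdis i j hij k _ (hf i hi) ?_
      have : (f i : ℝ) / M + k = f j / M := by
        have : (f j : ℝ) - f i = M * k := by exact_mod_cast hk
        field_simp; linarith
      rw [this]; exact hf j hj
    intro i hi j hj e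
    rcases lt_trichotomy i j with h | h | h
    · exact absurd e (key i j h hi hj)
    · exact h
    · exact absurd e.symm (key j i h hj hi)

lemma finite_setOf_le_length {σ τ : ℕ → ℝ}
    (hdis : ∀ i j : ℕ, i < j → ∀ (k : ℤ) (x : ℝ), x ∈ Icc (σ i) (τ i) → x + k ∉ Icc (σ j) (τ j))
    {δ : ℝ} (hδ : 0 < δ) : {n : ℕ | δ ≤ τ n - σ n}.Finite := by
  obtain ⟨M, hM⟩ := exists_nat_gt (1 / δ)
  have hM' : (0 : ℝ) < M := lt_trans (by positivity) hM
  rw [div_lt_iff₀ hδ] at hM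
  refine (finite_setOf_exists_div_mem (M := M) (by exact_mod_cast hM') hdis).subset fun n hn => ?_
  have hn : δ ≤ τ n - σ n := hn
  have h1 := Int.le_ceil (σ n * M)
  have h2 := Int.ceil_lt_add_one (σ n * M)
  refine ⟨⌈σ n * M⌉, ?_, ?_⟩
  · rwa [le_div_iff₀ hM']
  · rw [div_le_iff₀ hM']
    nlinarith

lemma floor_lt_of_forall_ne {s t : ℝ} (hst : s ≤ t)
    (hfree : ∀ m : ℤ, ∀ x ∈ Icc s t, 2 * x ≠ m) : (⌊s⌋ : ℝ) < s ∧ t < ⌊s⌋ + 1 := by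
  have h1 := Int.floor_le s
  have h2 := Int.lt_floor_add_one s
  refine ⟨h1.lt_of_ne fun e => hfree (2 * ⌊s⌋) s ⟨le_rfl, hst⟩ (by push_cast; rw [e]), ?_⟩
  by_contra! h
  exact hfree (2 * (⌊s⌋ + 1)) (⌊s⌋ + 1) ⟨h2.le, h⟩ (by push_cast; ring)

lemma iterate_linLift_stretch {α β b s t y z c : ℝ} (hb : b ∈ Ico (0 : ℝ) 1) (hst : s < t)
    {q : ℕ}
    (hfree : ∀ j < q, ∀ m : ℤ, ∀ x ∈ Icc ((linLift α b)^[j] s) ((linLift α b)^[j] t), 2 * x ≠ m)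
    (hc : ∀ j < q, c * ((linLift α b)^[j] t - (linLift α b)^[j] s) ≤
      ⌊(linLift α b)^[j] s⌋ + 1 - (linLift α b)^[j] t)
    (hy : ∀ j < q, (linLift β b)^[j] y ∈ Icc ((linLift α b)^[j] s) ((linLift α b)^[j] t))
    (hyz : y ≤ z) (hz : z ≤ y + c * (t - s)) :
    (linLift β b)^[q] z ≤
      (linLift β b)^[q] y + c * ((linLift α b)^[q] t - (linLift α b)^[q] s) := by
  induction q with
  | zero => simpa using hz
  | succ q ih =>
    have ih := ih (fun j hj => hfree j (by omega)) (fun j hj => hc j (by omega))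
      (fun j hj => hy j (by omega))
    have hlt := ((strictMono_linLift (α := α) hb).iterate q) hst
    have hle := ((strictMono_linLift (α := β) hb).iterate q).monotone hyz
    have hf := hfree q (by omega)
    obtain ⟨hk1, hk2⟩ := floor_lt_of_forall_ne hlt.le hf
    have hcq := hc q (by omega)
    have hyq := hy q (by omega)
    have key := linLift_stretch (α := α) (β := β) hb.1 hlt hf hk1 hk2 hyq.1 hle
      (by linarith [hyq.2])
    simp only [Function.iterate_succ_apply']
    have hlt' := strictMono_linLift (α := α) hb hlt
    refine sub_le_iff_le_add'.1 (le_of_mul_le_mul_left (key.trans ?_) (sub_pos.2 hlt))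
    nlinarith

namespace IsPlateau

variable {α b s t : ℝ}

/-- The gap between a plateau and the next integer becomes arbitrarily small relative to the length
of the plateau. -/
lemma exists_gap_lt (h : IsPlateau α b s t) (hb : b ∈ Ico (0 : ℝ) 1)
    (hfree : ∀ (j : ℕ) (m : ℤ), ∀ x ∈ Icc ((linLift α b)^[j] s) ((linLift α b)^[j] t), 2 * x ≠ m)
    {c : ℝ} (hc : 0 < c) :
    ∃ j : ℕ, ⌊(linLift α b)^[j] s⌋ + 1 - (linLift α b)^[j] t <
      c * ((linLift α b)^[j] t - (linLift α b)^[j] s) := by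
  by_contra! hcon
  have hb' : b ∈ Icc (0 : ℝ) 1 := ⟨hb.1, hb.2.le⟩
  have hpos : 0 < c * (t - s) := mul_pos hc (sub_pos.2 h.1)
  have hmono : ∀ n, StrictMono (linLift α b)^[n] := (strictMono_linLift (α := α) hb).iterate
  have e : linLiftLim α b (t + c * (t - s)) = linLiftLim α b t := by
    refine linLiftLim_congr hb' (D := 1) fun n => ?_
    have h1 := iterate_linLift_stretch (β := α) (q := n) hb h.1 (fun j _ => hfree j)
      (fun j _ => hcon j) (fun j _ => ⟨(hmono j).monotone h.1.le, le_rfl⟩)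
      (show t ≤ t + c * (t - s) by linarith) le_rfl
    have h2 := (hmono n).monotone (show t ≤ t + c * (t - s) by linarith)
    have h3 := hcon n
    have h4 := Int.floor_le ((linLift α b)^[n] s)
    have h5 := (hmono n).monotone h.1.le
    rw [abs_of_nonneg (by linarith)]
    linarith
  have := (h.2.2 _ (e.trans h.2.1.symm)).2
  linarith

lemma exists_mem_closure_hypSet_of_gap (h : IsPlateau α b s t) (hb : b ∈ Ico (0 : ℝ) 1)
    (hfree : ∀ (j : ℕ) (m : ℤ), ∀ x ∈ Icc ((linLift α b)^[j] s) ((linLift α b)^[j] t), 2 * x ≠ m)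
    {q : ℕ} (hq : 0 < q)
    (hdis : ∀ (k : ℤ), ∀ x ∈ Icc s t,
      x + k ∉ Icc ((linLift α b)^[q] s) ((linLift α b)^[q] t))
    {c : ℝ} (hc0 : 0 < c) (hc1 : c ≤ 1) (hgap : ⌊s⌋ + 1 - t = c * (t - s))
    (hgap_le : ∀ j < q, c * ((linLift α b)^[j] t - (linLift α b)^[j] s) ≤
      ⌊(linLift α b)^[j] s⌋ + 1 - (linLift α b)^[j] t)
    (hgap_lt : ⌊(linLift α b)^[q] s⌋ + 1 - (linLift α b)^[q] t <
      c * ((linLift α b)^[q] t - (linLift α b)^[q] s))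
    (hlen : (linLift α b)^[q] t - (linLift α b)^[q] s ≤ t - s) :
    ∃ α', |α' - α| ≤ (linLift α b)^[q] t - (linLift α b)^[q] s ∧
      ((α' : UnitAddCircle), b) ∈ closure hypSet := by
  have hb' : b ∈ Icc (0 : ℝ) 1 := ⟨hb.1, hb.2.le⟩
  have hmono : ∀ n, StrictMono (linLift α b)^[n] := (strictMono_linLift (α := α) hb).iterate
  have hltq := hmono q h.1
  obtain ⟨β, hβ, hβq, hβα⟩ := exists_param_iterate_eq (α := α) hb' hq t ((linLift α b)^[q] s)
  have hβα := hβα hltq.le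
  rw [abs_of_pos (sub_pos.2 hltq)] at hβ
  refine ⟨β, hβ, ?_⟩
  have hstep : ∀ x, linLift β b x ≤ linLift α b x := fun x => by unfold linLift; linarith
  have hy : ∀ j < q, (linLift β b)^[j] t ∈ Icc ((linLift α b)^[j] s) ((linLift α b)^[j] t) := by
    intro j hj
    constructor
    · by_contra! hlt
      have hbelow : ∀ i, (linLift β b)^[i + j] t < (linLift α b)^[i + j] s := by
        intro i
        induction i with
        | zero => simpa using hlt
        | succ i ih =>
          rw [show i + 1 + j = (i + j) + 1 by ring, Function.iterate_succ_apply',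
            Function.iterate_succ_apply']
          exact (hstep _).trans_lt (strictMono_linLift hb ih)
      have := hbelow (q - j)
      rw [Nat.sub_add_cancel hj.le] at this
      exact this.ne hβq
    · rcases j.eq_zero_or_pos with rfl | hj0
      · exact le_rfl
      · linarith [iterate_linLift_add_le hb' hβα t hj0]
  have hk0 := floor_lt_of_forall_ne h.1.le (hfree 0)
  have hkq := floor_lt_of_forall_ne hltq.le (hfree q)
  have hstretch := iterate_linLift_stretch (β := β) hb h.1 (fun j _ => hfree j) hgap_le hy
    hk0.2.le (by linarith)
  refine mem_closure_hypSet_of_crossing hb' hq (m := ⌊(linLift α b)^[q] s⌋ - ⌊s⌋) hk0.2 ?_ ?_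
  · rw [hβq]
    by_contra! hle
    refine hdis _ t ⟨h.1.le, le_rfl⟩ ⟨hle, ?_⟩
    push_cast
    nlinarith
  · rw [hβq] at hstretch
    push_cast
    nlinarith [hkq.2]

/-- Nondegenerate plateaus only exist at parameters in the closure of the hyperbolic set. -/
theorem mem_closure_hypSet (h : IsPlateau α b s t) (hb : b ∈ Ico (0 : ℝ) 1) :
    ((α : UnitAddCircle), b) ∈ closure hypSet := by
  by_contra hcon
  set σ : ℕ → ℝ := fun n => (linLift α b)^[n] s with hσ
  set τ : ℕ → ℝ := fun n => (linLift α b)^[n] t with hτ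
  have hP : ∀ n, IsPlateau α b (σ n) (τ n) := h.iterate hb
  have hpos : ∀ n, 0 < τ n - σ n := fun n => sub_pos.2 (hP n).1
  have itσ : ∀ n j, (linLift α b)^[j] (σ n) = σ (j + n) := fun n j =>
    (Function.iterate_add_apply _ _ _ _).symm
  have itτ : ∀ n j, (linLift α b)^[j] (τ n) = τ (j + n) := fun n j =>
    (Function.iterate_add_apply _ _ _ _).symm
  have hdis : ∀ i j : ℕ, i < j → ∀ (k : ℤ) (x : ℝ), x ∈ Icc (σ i) (τ i) →
      x + k ∉ Icc (σ j) (τ j) := fun i j hij k x hx hxk =>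
    hcon (h.mem_closure_hypSet_of_overlap hb hij hx hxk)
  refine hcon (mem_closure_hypSet_of_forall fun ε hε => ?_)
  obtain ⟨N, hN⟩ := ((finite_setOf_exists_div_mem two_pos hdis).union
    (finite_setOf_le_length hdis hε)).bddAbove
  have hfree : ∀ n, N < n → ∀ m : ℤ, ∀ x ∈ Icc (σ n) (τ n), 2 * x ≠ m := fun n hn m x hx e =>
    hn.not_ge (hN (Or.inl ⟨m, by rwa [← e, Nat.cast_ofNat, mul_div_cancel_left₀ x two_ne_zero]⟩))
  have hlen : ∀ n, N < n → τ n - σ n < ε := fun n hn => by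
    by_contra! hle
    exact hn.not_ge (hN (Or.inr hle))
  have hgap : ∀ n, N < n → ∀ c > 0, ∃ j, ⌊σ (j + n)⌋ + 1 - τ (j + n) <
      c * (τ (j + n) - σ (j + n)) := fun n hn c hc => by
    simpa only [itσ, itτ] using (hP n).exists_gap_lt hb
      (fun j => by rw [itσ, itτ]; exact hfree _ (by omega)) hc
  obtain ⟨n, ⟨hnN, hn1⟩, hmax⟩ : ∃ n, (N < n ∧ ⌊σ n⌋ + 1 - τ n ≤ τ n - σ n) ∧
      ∀ m, N < m → ⌊σ m⌋ + 1 - τ m ≤ τ m - σ m → τ m - σ m ≤ τ n - σ n := by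
    obtain ⟨j, hj⟩ := hgap (N + 1) (by omega) 1 one_pos
    rw [one_mul] at hj
    set n₀ := j + (N + 1) with hn₀
    obtain ⟨n, ⟨⟨hn, hn'⟩, hle⟩, hmax⟩ := exists_max_image
      {m | (N < m ∧ ⌊σ m⌋ + 1 - τ m ≤ τ m - σ m) ∧ τ n₀ - σ n₀ ≤ τ m - σ m}
      (fun m => τ m - σ m)
      ((finite_setOf_le_length hdis (hpos n₀)).subset fun m hm => hm.2)
      ⟨n₀, ⟨by omega, hj.le⟩, le_rfl⟩
    refine ⟨n, ⟨hn, hn'⟩, fun m hm hm' => ?_⟩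
    by_contra! hlt
    exact hlt.not_ge (hmax m ⟨⟨hm, hm'⟩, hle.trans hlt.le⟩)
  set c := (⌊σ n⌋ + 1 - τ n) / (τ n - σ n) with hc
  have hcmul : ⌊σ n⌋ + 1 - τ n = c * (τ n - σ n) := (div_mul_cancel₀ _ (hpos n).ne').symm
  have hc0 : 0 < c := div_pos
    (sub_pos.2 (floor_lt_of_forall_ne (hP n).1.le (hfree n hnN)).2) (hpos n)
  have hc1 : c ≤ 1 := (div_le_one (hpos n)).2 hn1
  classical
  have hex := hgap n hnN c hc0
  set q := Nat.find hex with hq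
  have hqlt : ⌊σ (q + n)⌋ + 1 - τ (q + n) < c * (τ (q + n) - σ (q + n)) := Nat.find_spec hex
  have hq0 : 0 < q := by
    rcases q.eq_zero_or_pos with e | e
    · rw [e, zero_add] at hqlt
      exact absurd hcmul hqlt.ne
    · exact e
  have hqle : τ (q + n) - σ (q + n) ≤ τ n - σ n :=
    hmax _ (by omega) (hqlt.le.trans (mul_le_of_le_one_left (hpos _).le hc1))
  obtain ⟨α', hα', hmem⟩ := (hP n).exists_mem_closure_hypSet_of_gap hb
    (fun j => by rw [itσ, itτ]; exact hfree _ (by omega)) hq0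
    (fun k x hx => by rw [itσ, itτ]; exact hdis n (q + n) (by omega) k x hx) hc0 hc1 hcmul
    (fun j hj => by rw [itσ, itτ]; exact not_lt.1 (Nat.find_min hex hj))
    (by rwa [itσ, itτ]) (by rwa [itσ, itτ])
  rw [itσ, itτ] at hα'
  exact ⟨α', b, hα'.trans_lt (hlen _ (by omega)), by simpa using hε, hmem⟩

end IsPlateau

lemma phiMap_coe {a : UnitAddCircle} {b α : ℝ} (hb : b ∈ Icc (0 : ℝ) 1)
    (hα : liftF a b = linLift α b) (x : ℝ) :
    phiMap a b (x : UnitAddCircle) = (linLiftLim α b x : ℝ) := by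
  have hPhi : Phi a b = linLiftLim α b := by
    funext y
    simp only [Phi, linLiftLim, hα]
  rw [phiMap, rep_coe, hPhi, ← coe_add_intCast _ ⌊x⌋, ← linLiftLim_add_int hb,
    Int.fract_add_floor]

/-- If the values of `linLiftLim α b` on a nondegenerate interval agree modulo `ℤ`, two of them are
equal. -/
lemma exists_lt_linLiftLim_eq {α b u v : ℝ} (hb : b ∈ Icc (0 : ℝ) 1) (huv : u < v)
    (h : ∀ x ∈ Icc u v, ∃ k : ℤ, linLiftLim α b x = linLiftLim α b u + k) :
    ∃ x y, x < y ∧ linLiftLim α b x = linLiftLim α b y := by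
  have hm := monotone_linLiftLim (α := α) hb
  by_contra! hne
  set w := min v (u + 1)
  have huw : u < w := lt_min huv (by linarith)
  have hwv : w ≤ v := min_le_left _ _
  obtain ⟨i, hi⟩ := h ((u + w) / 2) ⟨by linarith, by linarith⟩
  obtain ⟨j, hj⟩ := h w ⟨huw.le, hwv⟩
  have h1 := (hm (show u ≤ (u + w) / 2 by linarith)).lt_of_ne (hne _ _ (by linarith))
  have h2 := (hm (show (u + w) / 2 ≤ w by linarith)).lt_of_ne (hne _ _ (by linarith))
  have h3 := hm (show w ≤ u + (1 : ℤ) by push_cast; exact min_le_right _ _)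
  rw [linLiftLim_add_int hb] at h3
  rw [hi] at h1 h2
  rw [hj] at h2 h3
  have e1 : (0 : ℤ) < i := by exact_mod_cast (show (0 : ℝ) < i by linarith)
  have e2 : i < j := by exact_mod_cast (show (i : ℝ) < j by linarith)
  have e3 : j ≤ 1 := by exact_mod_cast (show (j : ℝ) ≤ 1 by push_cast at h3; linarith)
  omega

theorem stmt19 (a : UnitAddCircle) (b : ℝ) (hb : b ∈ Set.Icc (0:ℝ) 1)
    (h : (a, b) ∉ closure hypSet)
    (u v : ℝ) (huv : u < v) (J : Set UnitAddCircle)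
    (hJ : J = (fun t : ℝ => (t : UnitAddCircle)) '' Set.Icc u v)
    (hconst : ∀ y ∈ J, ∀ z ∈ J, phiMap a b y = phiMap a b z) :
    (⋃ m : ℕ, (plpdm a b)^[m] '' J) = Set.univ ∧
    (∀ y z : UnitAddCircle, phiMap a b y = phiMap a b z) := by
  exfalso
  obtain ⟨α, hα, hlift⟩ : ∃ α : ℝ, (α : UnitAddCircle) = a ∧ liftF a b = linLift α b := by
    refine ⟨_, ?_, liftF_eq a b⟩
    split_ifs
    · simp [coe_rep]
    · rw [add_zero, coe_rep]
  subst hα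
  rcases hb.2.eq_or_lt with rfl | hb1
  · exact h (mem_closure_hypSet_one α)
  subst hJ
  obtain ⟨x, y, hxy, he⟩ := exists_lt_linLiftLim_eq (α := α) hb huv fun x hx => by
    have := hconst _ (mem_image_of_mem _ hx) _ (mem_image_of_mem _ (left_mem_Icc.2 huv.le))
    rwa [phiMap_coe hb hlift, phiMap_coe hb hlift, coe_eq_coe_iff] at this
  obtain ⟨s, t, hst⟩ := exists_isPlateau hb hxy he
  exact h (hst.mem_closure_hypSet ⟨hb.1, hb1⟩)
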